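/- Let γ : I → X be a Lipschitz path in a metric space X with the property that for all Lipschitz f, g : X → ℝ, ∫_I (f∘γ)(t) · (d/dt)(g∘γ)(t) dt = 0 (γ has degree zero). Then the multiplicity m(γ,x) is finite and even for H^1-almost every x ∈ X. -/

import Mathlib

open MeasureTheory ENNReal Set

theorem hausdorffMeasure_image_eq_zero_of_edist_le {α β δ : Type*} [EMetricSpace β]
    [MeasurableSpace β] [BorelSpace β] [EMetricSpace δ] [MeasurableSpace δ] [BorelSpace δ]
    {f : α → β} {g : α → δ} {A : Set α} {C : NNReal} {d : ℝ} (hd : 0 ≤ d)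
    (h : ∀ s ∈ A, ∀ t ∈ A, edist (g s) (g t) ≤ C * edist (f s) (f t))
    (hf : μH[d] (f '' A) = 0) : μH[d] (g '' A) = 0 := by
  rcases A.eq_empty_or_nonempty with rfl | ⟨a₀, -⟩
  · simp
  have : Nonempty α := ⟨a₀⟩
  have hmem : ∀ y ∈ f '' A, Function.invFunOn f A y ∈ A := fun y hy => Function.invFunOn_mem hy
  have heq : ∀ y ∈ f '' A, f (Function.invFunOn f A y) = y := fun y hy => Function.invFunOn_eq hy
  have hlip : LipschitzOnWith C (g ∘ Function.invFunOn f A) (f '' A) := by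
    intro y hy z hz
    have := h _ (hmem y hy) _ (hmem z hz)
    rwa [heq y hy, heq z hz] at this
  have hsub : g '' A ⊆ (g ∘ Function.invFunOn f A) '' (f '' A) := by
    rintro _ ⟨t, ht, rfl⟩
    have hft := mem_image_of_mem f ht
    refine ⟨f t, hft, ?_⟩
    have := h _ (hmem _ hft) t ht
    rw [heq _ hft, edist_self, mul_zero] at this
    exact edist_le_zero.1 this
  refine measure_mono_null hsub (le_antisymm ?_ zero_le)
  simpa [hf] using hlip.hausdorffMeasure_image_le hd

theorem LipschitzWith.volume_image_eq_zero {K : NNReal} {f : ℝ → ℝ} (hf : LipschitzWith K f)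
    {s : Set ℝ} (hs : volume s = 0) : volume (f '' s) = 0 := by
  have := hf.hausdorffMeasure_image_le zero_le_one s
  rw [hausdorffMeasure_real, hs, mul_zero] at this
  exact le_antisymm this zero_le

theorem volume_image_eq_zero_of_hasDerivAt_zero {f : ℝ → ℝ} {s : Set ℝ}
    (hf : ∀ t ∈ s, HasDerivAt f 0 t) : volume (f '' s) = 0 :=
  addHaar_image_eq_zero_of_det_fderivWithin_eq_zero volume
    (f' := fun _ => ContinuousLinearMap.toSpanSingleton ℝ 0)
    (fun t ht => (hf t ht).hasFDerivAt.hasFDerivWithinAt) (by simp)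

theorem LipschitzWith.volume_image_eq_zero_of_ae_hasDerivAt_zero {K : NNReal} {f : ℝ → ℝ}
    (hf : LipschitzWith K f) {s : Set ℝ} (hs : ∀ᵐ t, t ∈ s → HasDerivAt f 0 t) :
    volume (f '' s) = 0 := by
  have h1 := volume_image_eq_zero_of_hasDerivAt_zero (f := f) (s := {t | HasDerivAt f 0 t})
    fun t ht => ht
  have h2 := hf.volume_image_eq_zero (ae_iff.1 hs)
  refine measure_mono_null ?_ (measure_union_null h1 h2)
  rw [← image_union]
  refine image_mono fun t ht => ?_
  by_cases h : HasDerivAt f 0 t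
  · exact Or.inl h
  · exact Or.inr fun h' => h (h' ht)

theorem LipschitzWith.volume_image_deriv_eq_zero {K : NNReal} {f : ℝ → ℝ}
    (hf : LipschitzWith K f) : volume (f '' {t | deriv f t = 0}) = 0 := by
  refine hf.volume_image_eq_zero_of_ae_hasDerivAt_zero ?_
  filter_upwards [hf.ae_differentiableAt_real] with t ht h0
  have := ht.hasDerivAt
  rwa [show deriv f t = 0 from h0] at this

/-- The points where a continuous function has nonzero derivative are covered by countably many
closed sets on which the function is injective with Lipschitz inverse. -/
theorem exists_closed_cover_antilipschitz {f : ℝ → ℝ} (hf : Continuous f) :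
    ∃ K : ℕ → Set ℝ, (∀ n, IsClosed (K n)) ∧
      (∀ n, ∃ c : NNReal, ∀ s ∈ K n, ∀ t ∈ K n, edist s t ≤ c * edist (f s) (f t)) ∧
      {t | deriv f t ≠ 0} ⊆ ⋃ n, K n := by
  let K : ℕ × ℤ → Set ℝ := fun p => Icc (p.2 / (p.1 + 1) : ℝ) ((p.2 + 1) / (p.1 + 1)) ∩
    {t | ∀ s, |s - t| < 2 / (p.1 + 1) → |s - t| ≤ (p.1 + 1) * |f s - f t|}
  suffices h : (∀ p, IsClosed (K p)) ∧
      (∀ p, ∃ c : NNReal, ∀ s ∈ K p, ∀ t ∈ K p, edist s t ≤ c * edist (f s) (f t)) ∧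
      {t | deriv f t ≠ 0} ⊆ ⋃ p, K p by
    obtain ⟨e, he⟩ := exists_surjective_nat (ℕ × ℤ)
    exact ⟨K ∘ e, fun n => h.1 _, fun n => h.2.1 _, h.2.2.trans (he.iUnion_comp K).ge⟩
  refine ⟨fun p => isClosed_Icc.inter ?_, fun ⟨n, j⟩ => ⟨n + 1, ?_⟩, ?_⟩
  · rw [show {t | ∀ s, |s - t| < 2 / ((p.1 : ℝ) + 1) → |s - t| ≤ (p.1 + 1) * |f s - f t|} =
      ⋂ s, ({t | 2 / ((p.1 : ℝ) + 1) ≤ |s - t|} ∪ {t | |s - t| ≤ (p.1 + 1) * |f s - f t|}) by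
        ext t; simp [imp_iff_not_or]]
    exact isClosed_iInter fun s => (isClosed_le (by fun_prop) (by fun_prop)).union
      (isClosed_le (by fun_prop) (by fun_prop))
  · rintro s ⟨hs, -⟩ t ⟨ht, ht'⟩
    have hn : (0 : ℝ) < n + 1 := by positivity
    have h1 : |s - t| < 2 / (n + 1) := by
      simp only [mem_Icc, add_div] at hs ht
      have h2 : (0 : ℝ) < 1 / (n + 1) := by positivity
      have h3 : (2 : ℝ) / (n + 1) = 2 * (1 / (n + 1)) := by ring
      rw [abs_lt]
      constructor <;> linarith [hs.1, hs.2, ht.1, ht.2]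
    have h4 := ht' s h1
    rw [edist_dist, edist_dist, Real.dist_eq, Real.dist_eq, ← ENNReal.ofReal_coe_nnreal,
      ← ENNReal.ofReal_mul (by positivity)]
    exact ENNReal.ofReal_le_ofReal (by simpa using h4)
  · intro t ht
    have hd : HasDerivAt f (deriv f t) t := (differentiableAt_of_deriv_ne_zero ht).hasDerivAt
    have hpos : 0 < |deriv f t| := abs_pos.2 ht
    have hev := (hasDerivAt_iff_isLittleO.1 hd).def (half_pos hpos)
    obtain ⟨δ, hδ, hball⟩ := Metric.eventually_nhds_iff.1 hev
    obtain ⟨n₁, hn₁⟩ := exists_nat_gt (2 / δ)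
    obtain ⟨n₂, hn₂⟩ := exists_nat_gt (2 / |deriv f t|)
    set n := max n₁ n₂ with hn
    have hn0 : (0 : ℝ) < n + 1 := by positivity
    have e1 : 2 / δ < n + 1 := by
      have : (n₁ : ℝ) ≤ n := by exact_mod_cast le_max_left _ _
      linarith
    have e2 : 2 / |deriv f t| < n + 1 := by
      have : (n₂ : ℝ) ≤ n := by exact_mod_cast le_max_right _ _
      linarith
    refine mem_iUnion.2 ⟨(n, ⌊t * (n + 1)⌋), ⟨?_, ?_⟩, ?_⟩
    · rw [div_le_iff₀ hn0]
      exact Int.floor_le _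
    · rw [le_div_iff₀ hn0]
      exact (Int.lt_floor_add_one _).le
    · intro s hs
      have hs' : dist s t < δ := by
        rw [Real.dist_eq]
        refine hs.trans ?_
        rw [div_lt_iff₀ hδ] at e1
        rw [div_lt_iff₀ hn0]
        linarith
      have h1 := hball hs'
      simp only [smul_eq_mul, Real.norm_eq_abs] at h1
      have h2 : |s - t| * |deriv f t| ≤ |f s - f t| + |f s - f t - (s - t) * deriv f t| := by
        rw [← abs_mul]
        have := abs_sub_abs_le_abs_sub ((s - t) * deriv f t) (f s - f t)
        rw [abs_sub_comm ((s - t) * deriv f t) (f s - f t)] at this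
        linarith
      have h3 : |s - t| * (|deriv f t| / 2) ≤ |f s - f t| := by linarith
      rw [div_lt_iff₀ hpos] at e2
      have h4 : |s - t| * 1 ≤ |s - t| * ((n + 1) * (|deriv f t| / 2)) :=
        mul_le_mul_of_nonneg_left (by linarith) (abs_nonneg _)
      calc |s - t| ≤ (n + 1) * (|s - t| * (|deriv f t| / 2)) := by linarith
        _ ≤ _ := mul_le_mul_of_nonneg_left h3 hn0.le

/-- The area formula in dimension one, counting preimages. -/
theorem lintegral_count_fiber_eq {f : ℝ → ℝ} (hf : Continuous f) {P : Set ℝ}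
    (hP : MeasurableSet P) (hP' : ∀ t ∈ P, deriv f t ≠ 0) :
    Measurable (fun y => Measure.count (P ∩ f ⁻¹' {y})) ∧
    ∫⁻ y, Measure.count (P ∩ f ⁻¹' {y}) = ∫⁻ t in P, ENNReal.ofReal |deriv f t| := by
  obtain ⟨K, hKc, hKa, hKcov⟩ := exists_closed_cover_antilipschitz hf
  set Q : ℕ → Set ℝ := fun n => P ∩ disjointed K n with hQ
  have hQm : ∀ n, MeasurableSet (Q n) := fun n =>
    hP.inter (MeasurableSet.disjointed (fun n => (hKc n).measurableSet) n)
  have hQd : Pairwise (Function.onFun Disjoint Q) := fun i j hij =>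
    (disjoint_disjointed K hij).mono inter_subset_right inter_subset_right
  have hQU : P = ⋃ n, Q n := by
    rw [hQ, ← inter_iUnion, iUnion_disjointed, inter_eq_left.2]
    exact fun t ht => hKcov (hP' t ht)
  have hQi : ∀ n, InjOn f (Q n) := by
    intro n s hs t ht hst
    obtain ⟨c, hc⟩ := hKa n
    have := hc s (disjointed_subset K n hs.2) t (disjointed_subset K n ht.2)
    rw [hst, edist_self, mul_zero] at this
    exact edist_le_zero.1 this
  have him : ∀ n, MeasurableSet (f '' Q n) := fun n =>
    (hQm n).image_of_continuousOn_injOn hf.continuousOn (hQi n)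
  have hcount : ∀ y, Measure.count (P ∩ f ⁻¹' {y}) = ∑' n, (f '' Q n).indicator 1 y := by
    intro y
    have hym : MeasurableSet (f ⁻¹' {y}) := hf.measurable (measurableSet_singleton y)
    conv_lhs => rw [hQU, iUnion_inter]
    rw [measure_iUnion (fun i j hij => (hQd hij).mono inter_subset_left inter_subset_left)
      fun n => (hQm n).inter hym]
    congr 1 with n
    by_cases hy : y ∈ f '' Q n
    · obtain ⟨t, ht, rfl⟩ := hy
      rw [indicator_of_mem (mem_image_of_mem f ht),
        show Q n ∩ f ⁻¹' {f t} = {t} from Subset.antisymm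
          (fun s hs => hQi n hs.1 ht hs.2) (singleton_subset_iff.2 ⟨ht, rfl⟩)]
      simp
    · rw [indicator_of_notMem hy, show Q n ∩ f ⁻¹' {y} = ∅ from
        eq_empty_of_forall_notMem fun t ht => hy ⟨t, ht.1, ht.2⟩]
      simp
  have hmeas : ∀ n, Measurable ((f '' Q n).indicator (1 : ℝ → ℝ≥0∞)) := fun n =>
    measurable_one.indicator (him n)
  simp_rw [hcount]
  refine ⟨Measurable.tsum hmeas, ?_⟩
  rw [lintegral_tsum fun n => (hmeas n).aemeasurable]
  conv_rhs => rw [hQU, lintegral_iUnion hQm hQd]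
  congr 1 with n
  rw [lintegral_indicator_one (him n), ← setLIntegral_one,
    lintegral_image_eq_lintegral_abs_deriv_mul (hQm n) (f' := deriv f) (fun t ht =>
      (differentiableAt_of_deriv_ne_zero (hP' t ht.1)).hasDerivAt.hasDerivWithinAt) (hQi n)]
  simp

theorem dist_le_of_forall_rat_abs_sub_dist_le {X : Type*} [MetricSpace X] {γ : ℝ → X}
    (hγ : Continuous γ) {s t M : ℝ}
    (h : ∀ q : ℚ, |dist (γ q) (γ t) - dist (γ q) (γ s)| ≤ M) : dist (γ s) (γ t) ≤ M := by
  have hcl : IsClosed {u : ℝ | |dist (γ u) (γ t) - dist (γ u) (γ s)| ≤ M} :=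
    isClosed_le (by fun_prop) continuous_const
  have := Rat.denseRange_cast.induction_on (p := fun u : ℝ =>
    |dist (γ u) (γ t) - dist (γ u) (γ s)| ≤ M) s hcl h
  simpa using this

theorem LipschitzWith.dist_left_comp {X : Type*} [MetricSpace X] {γ : ℝ → X} {L : NNReal}
    (hγ : LipschitzWith L γ) (p : X) : LipschitzWith L (fun t => dist p (γ t)) := by
  have := (LipschitzWith.dist_right p).comp hγ
  rwa [one_mul] at this

/-- A Lipschitz path maps the set where all distance functions to points of a dense subset have
zero derivative along the path to a null set. -/
theorem hausdorffMeasure_image_deriv_dist_eq_zero {X : Type*} [MetricSpace X] [MeasurableSpace X]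
    [BorelSpace X] {γ : ℝ → X} {L : NNReal} (hγ : LipschitzWith L γ) :
    μH[1] (γ '' {t | ∀ q : ℚ, deriv (fun s => dist (γ q) (γ s)) t = 0}) = 0 := by
  set Z := {t : ℝ | ∀ q : ℚ, deriv (fun s => dist (γ q) (γ s)) t = 0} with hZ
  have hZm : MeasurableSet Z := by
    rw [hZ, ofPred_forall]
    exact MeasurableSet.iInter fun q => measurable_deriv _ (measurableSet_singleton 0)
  set w : ℝ → ℝ := Zᶜ.indicator 1 with hw
  have hw1 : ∀ t, ‖w t‖ ≤ 1 := fun t => by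
    by_cases ht : t ∈ Z <;> simp [hw, ht]
  have hwm : Measurable w := measurable_one.indicator hZm.compl
  have hwl : LocallyIntegrable w := (locallyIntegrable_const (1 : ℝ)).mono
    hwm.aestronglyMeasurable (Filter.Eventually.of_forall fun t => by simpa using hw1 t)
  have hwi : ∀ s t, IntervalIntegrable w volume s t := fun s t =>
    (hwl.integrableOn_isCompact isCompact_uIcc).intervalIntegrable
  set φ : ℝ → ℝ := fun t => ∫ u in (0 : ℝ)..t, w u with hφ
  have hφsub : ∀ s t, φ t - φ s = ∫ u in s..t, w u := fun s t =>
    intervalIntegral.integral_interval_sub_left (hwi _ _) (hwi _ _)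
  have hφlip : LipschitzWith 1 φ := LipschitzWith.of_dist_le_mul fun s t => by
    rw [dist_comm, Real.dist_eq, hφsub, dist_comm, Real.dist_eq]
    exact intervalIntegral.norm_integral_le_of_norm_le_const fun u _ => hw1 u
  have hφ0 : volume (φ '' Z) = 0 := by
    refine hφlip.volume_image_eq_zero_of_ae_hasDerivAt_zero ?_
    filter_upwards [LocallyIntegrable.ae_hasDerivAt_integral hwl] with t ht htZ
    simpa [hw, htZ] using ht 0
  have key : ∀ s t, s ≤ t → dist (γ s) (γ t) ≤ L * dist (φ s) (φ t) := by
    intro s t hst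
    have h0 : 0 ≤ φ t - φ s := by
      rw [hφsub]
      exact intervalIntegral.integral_nonneg hst fun u _ =>
        indicator_nonneg (fun _ _ => zero_le_one) u
    rw [dist_comm (φ s), Real.dist_eq, abs_of_nonneg h0, hφsub,
      ← intervalIntegral.integral_const_mul]
    refine dist_le_of_forall_rat_abs_sub_dist_le hγ.continuous fun q => ?_
    have hq := hγ.dist_left_comp (γ q)
    rw [← (hq.lipschitzOnWith (s := uIcc s t)).absolutelyContinuousOnInterval.integral_deriv_eq_sub]
    rw [← Real.norm_eq_abs]
    refine intervalIntegral.norm_integral_le_of_norm_le hst (g := fun u => L * w u)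
      (Filter.Eventually.of_forall fun u _ => ?_) ((hwi s t).const_mul _)
    by_cases hu : u ∈ Z
    · simp [hw, hu, hu q]
    · simpa [hw, hu] using norm_deriv_le_of_lipschitz hq
  refine hausdorffMeasure_image_eq_zero_of_edist_le (f := φ) (C := L) zero_le_one ?_
    (by rwa [hausdorffMeasure_real])
  intro s _ t _
  rw [edist_dist, edist_dist, ← ENNReal.ofReal_coe_nnreal, ← ENNReal.ofReal_mul L.coe_nonneg]
  refine ENNReal.ofReal_le_ofReal ?_
  rcases le_total s t with h | h
  · exact key s t h
  · rw [dist_comm (γ s), dist_comm (φ s)]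
    exact key t s h

theorem setIntegral_preimage_closed_eq_zero {X : Type*} [MetricSpace X] {γ : ℝ → X}
    (hγ : Continuous γ) {I : Set ℝ} {u : ℝ → ℝ} (hu : IntegrableOn u I)
    (h : ∀ f : X → ℝ, (∃ K : NNReal, LipschitzWith K f) → ∫ t in I, f (γ t) * u t = 0)
    {F : Set X} (hF : IsClosed F) : ∫ t in I ∩ γ ⁻¹' F, u t = 0 := by
  have hδ : ∀ n : ℕ, (0 : ℝ) < 1 / (n + 1) := fun n => by positivity
  let f : ℕ → X → ℝ := fun n x => (thickenedIndicator (hδ n) F x : ℝ)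
  have hcont : ∀ n, Continuous (f n) := fun n => by fun_prop
  have hle : ∀ n x, ‖f n x‖ ≤ 1 := fun n x => by
    simpa [f] using thickenedIndicator_le_one (hδ n) F x
  have hlim : ∀ t, Filter.Tendsto (fun n => f n (γ t) * u t) Filter.atTop
      (nhds ((γ ⁻¹' F).indicator u t)) := by
    intro t
    have h1 := tendsto_pi_nhds.1 (thickenedIndicator_tendsto_indicator_closure hδ
      tendsto_one_div_add_atTop_nhds_zero_nat F) (γ t)
    have h2 := ((NNReal.continuous_coe.tendsto _).comp h1).mul_const (u t)
    rw [hF.closure_eq] at h2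
    have h3 : (γ ⁻¹' F).indicator u t =
        ((F.indicator (fun _ => (1 : NNReal)) (γ t) : NNReal) : ℝ) * u t := by
      by_cases ht : γ t ∈ F <;> simp [indicator, ht]
    rw [h3]
    exact h2
  have hmain := tendsto_integral_of_dominated_convergence (μ := volume.restrict I)
    (fun t => ‖u t‖) (F := fun n t => f n (γ t) * u t) (f := (γ ⁻¹' F).indicator u)
    (fun n => ((hcont n).comp hγ).aestronglyMeasurable.mul hu.aestronglyMeasurable)
    hu.norm (fun n => Filter.Eventually.of_forall fun t => by
      rw [norm_mul]
      exact mul_le_of_le_one_left (norm_nonneg _) (hle n _))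
    (Filter.Eventually.of_forall hlim)
  have hz : ∀ n, ∫ t in I, f n (γ t) * u t = 0 := fun n =>
    h (f n) ⟨_, lipschitzWith_thickenedIndicator (hδ n) F⟩
  simp_rw [hz] at hmain
  have h0 := tendsto_nhds_unique hmain tendsto_const_nhds
  rwa [integral_indicator (hF.preimage hγ).measurableSet,
    Measure.restrict_restrict (hF.preimage hγ).measurableSet, inter_comm] at h0

theorem exists_nat_encard_eq_two_mul {P N : Set ℝ} (hP : MeasurableSet P) (hN : MeasurableSet N)
    (hd : Disjoint P N) (h : (Measure.count P : ℝ≥0∞) = Measure.count N)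
    (hfin : (Measure.count P : ℝ≥0∞) < ∞) : ∃ k : ℕ, (P ∪ N).encard = 2 * k := by
  rw [Measure.count_apply hP, Measure.count_apply hN, ENat.toENNReal_inj] at h
  have hPf : P.encard ≠ ⊤ := by
    intro ht
    simp [Measure.count_apply hP, ht] at hfin
  obtain ⟨k, hk⟩ := ENat.ne_top_iff_exists.1 hPf
  exact ⟨k, by rw [encard_union_eq hd, ← h, ← hk, two_mul]⟩

theorem ae_eq_of_forall_isClosed_setLIntegral_eq {u v : ℝ → ℝ≥0∞} (hu : Measurable u)
    (hv : Measurable v) (hfin : ∫⁻ y, u y ≠ ∞)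
    (h : ∀ W : Set ℝ, IsClosed W → ∫⁻ y in W, u y = ∫⁻ y in W, v y) : u =ᵐ[volume] v := by
  have : IsFiniteMeasure (volume.withDensity u) := isFiniteMeasure_withDensity hfin
  rw [← withDensity_eq_iff hu.aemeasurable hv.aemeasurable hfin]
  refine ext_of_generate_finite _ (by
    rw [BorelSpace.measurable_eq (α := ℝ), borel_eq_generateFrom_isClosed]) isPiSystem_isClosed
    (fun W hW => ?_) ?_
  · rw [withDensity_apply _ hW.measurableSet, withDensity_apply _ hW.measurableSet, h W hW]
  · rw [withDensity_apply _ .univ, withDensity_apply _ .univ, h _ isClosed_univ]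

/-- The parity statement over a compact set on which a Lipschitz function is injective with
Lipschitz inverse. -/
theorem hausdorffMeasure_image_not_even_fiber_eq_zero {X : Type*} [MetricSpace X] [MeasurableSpace X]
    [BorelSpace X] {γ : ℝ → X} {L : NNReal} (hγ : LipschitzWith L γ) {I : Set ℝ}
    (hI : IsCompact I) {g : X → ℝ} {G : NNReal} (hg : LipschitzWith G g)
    (hdeg : ∀ f : X → ℝ, (∃ K : NNReal, LipschitzWith K f) →
      ∫ t in I, f (γ t) * deriv (g ∘ γ) t = 0)
    {S : Set X} (hS : IsClosed S) {C : NNReal}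
    (hSg : ∀ x ∈ S, ∀ y ∈ S, edist x y ≤ C * edist (g x) (g y)) :
    μH[1] (γ '' (I ∩ γ ⁻¹' S ∩
      {t | ¬ ∃ k : ℕ, (γ ⁻¹' {γ t} ∩ I).encard = 2 * k})) = 0 := by
  set h : ℝ → ℝ := g ∘ γ with hh
  have hlip : LipschitzWith (G * L) h := hg.comp hγ
  have hIm := hI.measurableSet
  have hdm : Measurable (deriv h) := measurable_deriv h
  have hbd : ∀ t, ‖deriv h t‖ ≤ (G * L : NNReal) := fun t => norm_deriv_le_of_lipschitz hlip
  have hint : IntegrableOn (deriv h) I :=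
    Measure.integrableOn_of_bounded hI.measure_lt_top.ne hdm.aestronglyMeasurable
      (Filter.Eventually.of_forall hbd)
  set T := I ∩ γ ⁻¹' S with hT
  have hTm : MeasurableSet T := hIm.inter (hS.preimage hγ.continuous).measurableSet
  set P := T ∩ {t | 0 < deriv h t} with hP
  set N := T ∩ {t | deriv h t < 0} with hN
  have hPm : MeasurableSet P := hTm.inter (measurableSet_lt measurable_const hdm)
  have hNm : MeasurableSet N := hTm.inter (measurableSet_lt hdm measurable_const)
  obtain ⟨hPc, hPi⟩ := lintegral_count_fiber_eq hlip.continuous hPm fun t ht => ht.2.ne'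
  have hNc := (lintegral_count_fiber_eq hlip.continuous hNm fun t ht => ht.2.ne).1
  have hPfin : ∫⁻ y, Measure.count (P ∩ h ⁻¹' {y}) ≠ ∞ := by
    rw [hPi]
    have := (hint.mono_set (inter_subset_left.trans inter_subset_left : P ⊆ I)).norm
    simpa using this.lintegral_lt_top.ne
  have hloc : ∀ (A W : Set ℝ), MeasurableSet A → IsClosed W → (∀ t ∈ A, deriv h t ≠ 0) →
      ∫⁻ y in W, Measure.count (A ∩ h ⁻¹' {y}) =
        ∫⁻ t in A ∩ h ⁻¹' W, ENNReal.ofReal |deriv h t| := by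
    intro A W hA hW hA'
    rw [← (lintegral_count_fiber_eq hlip.continuous
      (hA.inter (hW.preimage hlip.continuous).measurableSet) fun t ht => hA' t ht.1).2,
      ← lintegral_indicator hW.measurableSet]
    congr 1 with y
    by_cases hy : y ∈ W
    · rw [indicator_of_mem hy]
      congr 1
      ext t
      simp only [mem_inter_iff, mem_preimage, mem_singleton_iff]
      exact ⟨fun ⟨h1, h2⟩ => ⟨⟨h1, h2 ▸ hy⟩, h2⟩, fun ⟨h1, h2⟩ => ⟨h1.1, h2⟩⟩
    · rw [indicator_of_notMem hy, eq_comm, show A ∩ h ⁻¹' W ∩ h ⁻¹' {y} = ∅ from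
        eq_empty_of_forall_notMem fun t ht => hy (by
          have h1 : h t = y := ht.2
          exact h1 ▸ ht.1.2)]
      simp
  have hae : (fun y => Measure.count (P ∩ h ⁻¹' {y})) =ᵐ[volume]
      fun y => Measure.count (N ∩ h ⁻¹' {y}) := by
    refine ae_eq_of_forall_isClosed_setLIntegral_eq hPc hNc hPfin fun W hW => ?_
    rw [hloc P W hPm hW fun t ht => ht.2.ne', hloc N W hNm hW fun t ht => ht.2.ne]
    set Q := I ∩ γ ⁻¹' (S ∩ g ⁻¹' W) with hQ
    have hFc : IsClosed (S ∩ g ⁻¹' W) := hS.inter (hW.preimage hg.continuous)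
    have hQm : MeasurableSet Q := hIm.inter (hFc.preimage hγ.continuous).measurableSet
    have hQz : ∫ t in Q, deriv h t = 0 :=
      setIntegral_preimage_closed_eq_zero hγ.continuous hint hdeg hFc
    have hQi : IntegrableOn (deriv h) Q := hint.mono_set inter_subset_left
    rw [integral_eq_lintegral_pos_part_sub_lintegral_neg_part hQi, sub_eq_zero] at hQz
    replace hQz := (ENNReal.toReal_eq_toReal_iff' hQi.lintegral_lt_top.ne
      hQi.neg.lintegral_lt_top.ne).1 hQz
    have hPQ : P ∩ h ⁻¹' W = {t | 0 < deriv h t} ∩ Q := by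
      ext t; simp [hP, hQ, hT, hh]; tauto
    have hNQ : N ∩ h ⁻¹' W = {t | deriv h t < 0} ∩ Q := by
      ext t; simp [hN, hQ, hT, hh]; tauto
    rw [hPQ, hNQ, ← Measure.restrict_restrict (measurableSet_lt measurable_const hdm),
      ← Measure.restrict_restrict (measurableSet_lt hdm measurable_const),
      ← lintegral_indicator (measurableSet_lt measurable_const hdm),
      ← lintegral_indicator (measurableSet_lt hdm measurable_const)]
    have hpos : {t | 0 < deriv h t}.indicator (fun t => ENNReal.ofReal |deriv h t|) =
        fun t => ENNReal.ofReal (deriv h t) := by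
      ext t
      rcases lt_or_ge 0 (deriv h t) with ht | ht
      · simp [ht, abs_of_pos ht]
      · simp [ht.not_gt, ENNReal.ofReal_of_nonpos ht]
    have hneg : {t | deriv h t < 0}.indicator (fun t => ENNReal.ofReal |deriv h t|) =
        fun t => ENNReal.ofReal ((-deriv h) t) := by
      ext t
      rcases lt_or_ge (deriv h t) 0 with ht | ht
      · simp [ht, abs_of_neg ht]
      · simp [ht.not_gt, ht]
    rw [hpos, hneg, hQz]
  have hfin := ae_lt_top hPc hPfin
  have hcrit : ∀ᵐ y, y ∉ h '' {t | deriv h t = 0} :=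
    measure_eq_zero_iff_ae_notMem.1 hlip.volume_image_deriv_eq_zero
  refine hausdorffMeasure_image_eq_zero_of_edist_le (f := h) (C := C) zero_le_one
    (fun s hs t ht => hSg _ hs.1.2 _ ht.1.2) ?_
  rw [hausdorffMeasure_real, measure_eq_zero_iff_ae_notMem]
  filter_upwards [hae, hfin, hcrit] with y hy1 hy2 hy3
  rintro ⟨t, ⟨htT, ht⟩, rfl⟩
  refine ht ?_
  have hym : MeasurableSet (h ⁻¹' {h t}) :=
    hlip.continuous.measurable (measurableSet_singleton _)
  obtain ⟨k, hk⟩ := exists_nat_encard_eq_two_mul (hPm.inter hym) (hNm.inter hym)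
    (disjoint_left.2 fun s hs hs' => lt_asymm (mem_ofPred.1 hs.1.2) (mem_ofPred.1 hs'.1.2)) hy1 hy2
  refine ⟨k, ?_⟩
  rw [← hk]
  congr 1
  ext s
  constructor
  · rintro ⟨hs, hsI⟩
    have hs : γ s = γ t := hs
    have hsT : s ∈ T := ⟨hsI, show γ s ∈ S from hs ▸ htT.2⟩
    have hst : h s = h t := congrArg g hs
    rcases lt_trichotomy (deriv h s) 0 with h0 | h0 | h0
    · exact Or.inr ⟨⟨hsT, h0⟩, hst⟩
    · exact absurd ⟨s, h0, hst⟩ hy3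
    · exact Or.inl ⟨⟨hsT, h0⟩, hst⟩
  · have aux : ∀ s ∈ T, h s = h t → s ∈ γ ⁻¹' {γ t} ∩ I := fun s hsT hst => by
      have h1 := hSg _ hsT.2 _ htT.2
      rw [show g (γ s) = g (γ t) from hst, edist_self, mul_zero] at h1
      exact ⟨edist_le_zero.1 h1, hsT.1⟩
    rintro (hs | hs)
    · exact aux s hs.1.1 hs.2
    · exact aux s hs.1.1 hs.2

theorem ae_even_encard_fiber_of_lipschitzWith {X : Type*} [MetricSpace X] [MeasurableSpace X]
    [BorelSpace X] {γ : ℝ → X} {L : NNReal} (hγ : LipschitzWith L γ) {I : Set ℝ}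
    (hI : IsCompact I)
    (hdeg : ∀ (f g : X → ℝ), (∃ Kf : NNReal, LipschitzWith Kf f) →
      (∃ Kg : NNReal, LipschitzWith Kg g) → ∫ t in I, f (γ t) * deriv (g ∘ γ) t = 0) :
    ∀ᵐ x ∂(μH[1] : Measure X), ∃ k : ℕ, (γ ⁻¹' {x} ∩ I).encard = 2 * k := by
  let g : ℚ → X → ℝ := fun q x => dist (γ q) x
  have hg : ∀ q, LipschitzWith 1 (g q) := fun q => LipschitzWith.dist_right _
  have hgγ : ∀ q, Continuous (g q ∘ γ) := fun q => (hg q).continuous.comp hγ.continuous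
  choose K hKc hKa hKcov using fun q => exists_closed_cover_antilipschitz (hgγ q)
  let S : ℚ → ℕ → Set X := fun q n => γ '' (I ∩ K q n)
  let B : Set ℝ := {t | ¬ ∃ k : ℕ, (γ ⁻¹' {γ t} ∩ I).encard = 2 * k}
  have hbad : ∀ q n, μH[1] (γ '' (I ∩ γ ⁻¹' S q n ∩ B)) = 0 := by
    intro q n
    obtain ⟨c, hc⟩ := hKa q n
    refine hausdorffMeasure_image_not_even_fiber_eq_zero hγ hI (hg q) (fun f hf => hdeg f (g q) hf ⟨1, hg q⟩)
      ((hI.inter_right (hKc q n)).image hγ.continuous).isClosed (C := L * c) ?_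
    rintro _ ⟨s, hs, rfl⟩ _ ⟨t, ht, rfl⟩
    refine (hγ s t).trans ?_
    rw [ENNReal.coe_mul, mul_assoc]
    exact mul_le_mul_right (hc s hs.2 t ht.2) _
  refine ae_iff.2 (measure_mono_null ?_ (measure_union_null
    (hausdorffMeasure_image_deriv_dist_eq_zero hγ)
    (measure_iUnion_null fun q => measure_iUnion_null fun n => hbad q n)))
  intro x hx
  by_cases hne : (γ ⁻¹' {x} ∩ I).Nonempty
  · obtain ⟨t, ht, htI⟩ := hne
    obtain rfl : γ t = x := ht
    by_cases hZ : ∀ q : ℚ, deriv (fun s => dist (γ q) (γ s)) t = 0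
    · exact Or.inl ⟨t, hZ, rfl⟩
    · push Not at hZ
      obtain ⟨q, hq⟩ := hZ
      obtain ⟨n, hn⟩ := mem_iUnion.1 (hKcov q hq)
      exact Or.inr (mem_iUnion₂.2 ⟨q, n, t, ⟨⟨htI, t, ⟨htI, hn⟩, rfl⟩, hx⟩, rfl⟩)
  · exact absurd ⟨0, by simp [not_nonempty_iff_eq_empty.1 hne]⟩ hx

theorem stmt19 {X : Type*} [MetricSpace X] [MeasurableSpace X] [BorelSpace X]
    (a b : ℝ) (hab : a ≤ b) (γ : ℝ → X) (L : NNReal) (hγ : LipschitzOnWith L γ (Icc a b))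
    (hdeg : ∀ (f g : X → ℝ), (∃ Kf : NNReal, LipschitzWith Kf f) →
      (∃ Kg : NNReal, LipschitzWith Kg g) →
      ∫ t in Icc a b, f (γ t) * deriv (g ∘ γ) t = 0) :
    ∀ᵐ x ∂(μH[1] : Measure X), ∃ k : ℕ, (γ ⁻¹' {x} ∩ Icc a b).encard = 2 * k := by
  set γ' : ℝ → X := IccExtend hab ((Icc a b).domRestrict γ) with hγ'
  have heq : ∀ t ∈ Icc a b, γ' t = γ t := fun t ht => IccExtend_of_mem hab _ ht
  have hlip : LipschitzWith L γ' := by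
    have := hγ.to_restrict.comp (LipschitzWith.projIcc hab)
    rwa [mul_one] at this
  have hfib : ∀ x, γ ⁻¹' {x} ∩ Icc a b = γ' ⁻¹' {x} ∩ Icc a b := fun x => by
    ext t
    simp only [mem_inter_iff, mem_preimage, and_congr_left_iff]
    intro ht
    rw [heq t ht]
  simp_rw [hfib]
  refine ae_even_encard_fiber_of_lipschitzWith hlip isCompact_Icc fun f g hf hg => ?_
  rw [← hdeg f g hf hg, integral_Icc_eq_integral_Ioo, integral_Icc_eq_integral_Ioo]
  refine setIntegral_congr_fun measurableSet_Ioo fun t ht => ?_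
  have hev : g ∘ γ' =ᶠ[nhds t] g ∘ γ := by
    filter_upwards [Icc_mem_nhds ht.1 ht.2] with s hs
    simp [heq s hs]
  simp only [hev.deriv_eq, heq t (Ioo_subset_Icc_self ht)]
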